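/- arXiv:1604.01612 — 2 statements merged into one kernel-verified Lean document; each statement's English description precedes it below -/
import Mathlib

section
/- Let n ≥ 2. The sequences α = (3n−3, n−1) and β = (n−2, n−3, …, 1) satisfy S_C(α,β) = {1, 2, …, 4n−5}; equivalently, the bundle S^{2n−3}U* is an Ulrich bundle on IGr(2, 2n). Moreover, if n − 1 is a power of 2 (i.e. n = 2^r + 1 or n = 2), then this is the unique pair of integer sequences α₁ > α₂ and β₁ > … > β_{n−2} > 0 with S_C(α,β) = {1, 2, …, 4n−5}. -/
/-- The set `S_C(α,β) = {αᵢ + βⱼ} ∪ {αᵢ - βⱼ} ∪ {(αᵢ + αⱼ)/2 : i ≤ j, αᵢ + αⱼ even}`,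
with 0-based indices `i < k`, `j < l`. -/
def SC (k l : ℕ) (α β : ℕ → ℤ) : Set ℤ :=
  {t | (∃ i < k, ∃ j < l, t = α i + β j) ∨
       (∃ i < k, ∃ j < l, t = α i - β j) ∨
       (∃ i j, i ≤ j ∧ j < k ∧ 2 * t = α i + α j)}

theorem sub_one_mul_sum_Icc_zpow {K : Type*} [Field K] {z : K} (M : ℕ) :
    (z - 1) * ∑ i ∈ Finset.Icc (1 : ℤ) M, z ^ i = z ^ (M + 1) - z := by
  induction M with
  | zero => simp
  | succ k ih =>
    have h : Finset.Icc (1 : ℤ) ((k + 1 : ℕ) : ℤ) =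
        insert ((k + 1 : ℕ) : ℤ) (Finset.Icc (1 : ℤ) k) := by
      ext x
      simp only [Finset.mem_Icc, Finset.mem_insert]
      omega
    rw [h, Finset.sum_insert (by simp), mul_add, ih, zpow_natCast]
    ring

/-- If `{1, …, 4N-1}` is covered by two translates, at distance `2d`, of a set of at most `2N-1`
integers together with the point `2N`, then `N` is an odd multiple of `d`. -/
theorem exists_odd_mul_of_Icc_eq_translates {N d : ℕ} (hN : 0 < N) (hd : 0 < d) {a b : ℤ}
    (hab : a = b + 2 * d) (C : Finset ℤ) (hC : C.card ≤ 2 * N - 1)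
    (h : Finset.Icc (1 : ℤ) (4 * N - 1 : ℕ) =
      insert (2 * (N : ℤ)) (C.image (a + ·) ∪ C.image (b + ·))) :
    ∃ q : ℕ, Odd q ∧ N = d * q := by
  have ha : (C.image (a + ·)).card = C.card :=
    Finset.card_image_of_injective _ (add_right_injective a)
  have hb : (C.image (b + ·)).card = C.card :=
    Finset.card_image_of_injective _ (add_right_injective b)
  have hcard := congrArg Finset.card h
  rw [Int.card_Icc] at hcard
  have hunion := Finset.card_union_add_card_inter (C.image (a + ·)) (C.image (b + ·))
  have hins := Finset.card_insert_le (2 * (N : ℤ)) (C.image (a + ·) ∪ C.image (b + ·))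
  have hdisj : Disjoint (C.image (a + ·)) (C.image (b + ·)) := by
    rw [Finset.disjoint_iff_inter_eq_empty, ← Finset.card_eq_zero]
    omega
  have hnot : 2 * (N : ℤ) ∉ C.image (a + ·) ∪ C.image (b + ·) := by
    intro hmem
    rw [Finset.insert_eq_of_mem hmem] at hcard
    omega
  have hprim := Complex.isPrimitiveRoot_exp (4 * d) (by omega)
  set z : ℂ := Complex.exp (2 * Real.pi * Complex.I / (4 * d : ℕ))
  have hz0 : z ≠ 0 := Complex.exp_ne_zero _
  have hneg : z ^ (2 * d) = -1 := by
    have hsq : (z ^ (2 * d)) ^ 2 = 1 := by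
      rw [← pow_mul, ← hprim.pow_eq_one]
      congr 1
      ring
    rcases sq_eq_one_iff.mp hsq with h1 | h1
    · have := Nat.le_of_dvd (by omega) (hprim.dvd_of_pow_eq_one _ h1)
      omega
    · exact h1
  have hsum : ∑ i ∈ Finset.Icc (1 : ℤ) (4 * N - 1 : ℕ), z ^ i = z ^ (2 * N) := by
    rw [h, Finset.sum_insert hnot, Finset.sum_union hdisj,
      Finset.sum_image (add_right_injective a).injOn,
      Finset.sum_image (add_right_injective b).injOn, ← Finset.sum_add_distrib,
      Finset.sum_eq_zero]
    · rw [add_zero]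
      exact_mod_cast zpow_natCast z (2 * N)
    · intro c _
      have h2 : z ^ (2 * (d : ℤ)) = -1 := by
        rw [← hneg]
        exact_mod_cast zpow_natCast z (2 * d)
      have h3 : a + c = (b + c) + 2 * d := by omega
      rw [h3, zpow_add₀ hz0, h2]
      ring
  have hgeom := sub_one_mul_sum_Icc_zpow (z := z) (4 * N - 1)
  rw [hsum, show 4 * N - 1 + 1 = 2 * N + 2 * N by omega, pow_add] at hgeom
  have hprod : (z ^ (2 * N) - z) * (z ^ (2 * N) + 1) = 0 := by linear_combination -hgeom
  rcases mul_eq_zero.mp hprod with h1 | h1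
  · exfalso
    have h2 : z ^ (2 * N - 1) = 1 := by
      apply mul_right_cancel₀ hz0
      rw [← pow_succ, show 2 * N - 1 + 1 = 2 * N by omega, one_mul]
      exact sub_eq_zero.mp h1
    obtain ⟨k, hk⟩ := hprim.dvd_of_pow_eq_one _ h2
    rw [mul_assoc] at hk
    omega
  · have h2 : z ^ (2 * N) = -1 := eq_neg_of_add_eq_zero_left h1
    have h3 : z ^ (4 * N) = 1 := by
      rw [show 4 * N = 2 * N + 2 * N by ring, pow_add, h2]
      ring
    obtain ⟨q, hq⟩ := hprim.dvd_of_pow_eq_one _ h3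
    rw [mul_assoc] at hq
    have hq' : N = d * q := by omega
    refine ⟨q, ?_, hq'⟩
    rw [hq', ← mul_assoc, pow_mul, hneg] at h2
    exact (neg_one_pow_eq_neg_one_iff_odd (by norm_num)).mp h2

theorem eq_of_strictAnti_of_mem_Icc {l : ℕ} {β : ℕ → ℤ}
    (hanti : ∀ i j, i < j → j < l → β j < β i) (hpos : ∀ j < l, 0 < β j)
    (hle : ∀ j < l, β j ≤ l) : ∀ j < l, β j = (l : ℤ) - j := by
  have hup : ∀ j < l, β j ≤ (l : ℤ) - j := by
    intro j
    induction j with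
    | zero => intro h; simpa using hle 0 h
    | succ k ih =>
      intro h
      have h1 := ih (by omega)
      have h2 := hanti k (k + 1) (by omega) h
      push_cast
      omega
  have hlow : ∀ i j, j + i + 1 = l → (i : ℤ) + 1 ≤ β j := by
    intro i
    induction i with
    | zero => intro j hj; have := hpos j (by omega); push_cast; omega
    | succ k ih =>
      intro j hj
      have h1 := ih (j + 1) (by omega)
      have h2 := hanti j (j + 1) (by omega) (by omega)
      push_cast
      omega
  intro j hj
  have h1 := hup j hj
  have h2 := hlow (l - 1 - j) j (by omega)
  omega

theorem mem_SC_two {l : ℕ} {α β : ℕ → ℤ} {t : ℤ} :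
    t ∈ SC 2 l α β ↔
      (∃ j < l, t = α 0 + β j ∨ t = α 1 + β j ∨ t = α 0 - β j ∨ t = α 1 - β j) ∨
        t = α 0 ∨ t = α 1 ∨ 2 * t = α 0 + α 1 := by
  constructor
  · rintro (⟨i, hi, j, hj, h⟩ | ⟨i, hi, j, hj, h⟩ | ⟨i, j, hij, hj, h⟩)
    · exact Or.inl ⟨j, hj, by interval_cases i <;> simp [h]⟩
    · exact Or.inl ⟨j, hj, by interval_cases i <;> simp [h]⟩
    · right
      interval_cases j <;> interval_cases i <;> omega
  · rintro (⟨j, hj, h | h | h | h⟩ | h | h | h)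
    · exact Or.inl ⟨0, by omega, j, hj, h⟩
    · exact Or.inl ⟨1, by omega, j, hj, h⟩
    · exact Or.inr (Or.inl ⟨0, by omega, j, hj, h⟩)
    · exact Or.inr (Or.inl ⟨1, by omega, j, hj, h⟩)
    · exact Or.inr (Or.inr ⟨0, 0, by omega, by omega, by omega⟩)
    · exact Or.inr (Or.inr ⟨1, 1, by omega, by omega, by omega⟩)
    · exact Or.inr (Or.inr ⟨0, 1, by omega, by omega, h⟩)

theorem SC_two_reflect {l : ℕ} {α β : ℕ → ℤ} {t : ℤ} (ht : t ∈ SC 2 l α β) :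
    α 0 + α 1 - t ∈ SC 2 l α β := by
  rw [mem_SC_two] at ht ⊢
  rcases ht with ⟨j, hj, h⟩ | h
  · exact Or.inl ⟨j, hj, by omega⟩
  · right
    omega

/-- The set `{0} ∪ {±β₀, …, ±β_{l-1}}`. -/
def signedValues (l : ℕ) (β : ℕ → ℤ) : Finset ℤ :=
  insert 0 ((Finset.range l).image β ∪ (Finset.range l).image (fun j => -β j))

theorem card_signedValues_le (l : ℕ) (β : ℕ → ℤ) : (signedValues l β).card ≤ 2 * l + 1 := by
  have h1 : ((Finset.range l).image β).card ≤ l := by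
    simpa using Finset.card_image_le (s := Finset.range l) (f := β)
  have h2 : ((Finset.range l).image (fun j => -β j)).card ≤ l := by
    simpa using Finset.card_image_le (s := Finset.range l) (f := fun j => -β j)
  have h3 := Finset.card_union_le ((Finset.range l).image β)
    ((Finset.range l).image (fun j => -β j))
  have h4 := Finset.card_insert_le 0
    ((Finset.range l).image β ∪ (Finset.range l).image (fun j => -β j))
  unfold signedValues
  omega

theorem mem_signedValues {l : ℕ} {β : ℕ → ℤ} {c : ℤ} :
    c ∈ signedValues l β ↔ c = 0 ∨ ∃ j < l, c = β j ∨ c = -β j := by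
  simp only [signedValues, Finset.mem_insert, Finset.mem_union, Finset.mem_image,
    Finset.mem_range]
  grind

theorem mem_SC_two_iff_signedValues {l : ℕ} {α β : ℕ → ℤ} {t : ℤ} :
    t ∈ SC 2 l α β ↔ 2 * t = α 0 + α 1 ∨
      t ∈ (signedValues l β).image (α 0 + ·) ∪ (signedValues l β).image (α 1 + ·) := by
  simp only [mem_SC_two, Finset.mem_union, Finset.mem_image, mem_signedValues]
  constructor
  · rintro (⟨j, hj, h | h | h | h⟩ | h | h | h)
    · exact Or.inr (Or.inl ⟨β j, Or.inr ⟨j, hj, by omega⟩, h.symm⟩)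
    · exact Or.inr (Or.inr ⟨β j, Or.inr ⟨j, hj, by omega⟩, h.symm⟩)
    · exact Or.inr (Or.inl ⟨-β j, Or.inr ⟨j, hj, by omega⟩, by omega⟩)
    · exact Or.inr (Or.inr ⟨-β j, Or.inr ⟨j, hj, by omega⟩, by omega⟩)
    · exact Or.inr (Or.inl ⟨0, by simp, by omega⟩)
    · exact Or.inr (Or.inr ⟨0, by simp, by omega⟩)
    · exact Or.inl h
  · rintro (h | ⟨c, rfl | ⟨j, hj, hc⟩, h⟩ | ⟨c, rfl | ⟨j, hj, hc⟩, h⟩)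
    · omega
    · omega
    · exact Or.inl ⟨j, hj, by omega⟩
    · omega
    · exact Or.inl ⟨j, hj, by omega⟩

theorem add_eq_of_SC_two_eq_Icc {l : ℕ} {α β : ℕ → ℤ} {M : ℤ} (hM : 1 ≤ M)
    (h : SC 2 l α β = Set.Icc 1 M) : α 0 + α 1 = M + 1 := by
  have h1 : (1 : ℤ) ∈ SC 2 l α β := by rw [h]; exact ⟨le_rfl, hM⟩
  have h2 : M ∈ SC 2 l α β := by rw [h]; exact ⟨hM, le_rfl⟩
  have h3 := SC_two_reflect h1
  have h4 := SC_two_reflect h2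
  rw [h, Set.mem_Icc] at h3 h4
  omega

/-- The sequences `α = (3n-3, n-1)` and `β = (n-2, n-3, …, 1)` satisfy
`S_C(α,β) = {1, …, 4n-5}` (i.e. `S^{2n-3}U*` is Ulrich on `IGr(2,2n)`), and
if `n - 1` is a power of `2` this is the unique pair of sequences
`α₁ > α₂`, `β₁ > … > β_{n-2} > 0` with `S_C(α,β) = {1, …, 4n-5}`. -/
theorem stmt5 (n : ℕ) (hn : 2 ≤ n) :
    SC 2 (n - 2) (fun i => if i = 0 then 3 * (n : ℤ) - 3 else (n : ℤ) - 1)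
        (fun j => (n : ℤ) - 2 - j) = Set.Icc (1 : ℤ) (4 * (n : ℤ) - 5) ∧
    ((∃ r : ℕ, n - 1 = 2 ^ r) →
      ∀ α β : ℕ → ℤ, α 1 < α 0 →
        (∀ i j, i < j → j < n - 2 → β j < β i) →
        (∀ j < n - 2, 0 < β j) →
        SC 2 (n - 2) α β = Set.Icc (1 : ℤ) (4 * (n : ℤ) - 5) →
        α 0 = 3 * (n : ℤ) - 3 ∧ α 1 = (n : ℤ) - 1 ∧
          ∀ j < n - 2, β j = (n : ℤ) - 2 - j) := by
  constructor
  · ext t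
    simp only [mem_SC_two, Set.mem_Icc, if_true, one_ne_zero, if_false]
    constructor
    · rintro (⟨j, hj, h⟩ | h) <;> omega
    · rintro ⟨h1, h2⟩
      by_cases c1 : t = 3 * (n : ℤ) - 3 ∨ t = (n : ℤ) - 1 ∨
          2 * t = 3 * (n : ℤ) - 3 + ((n : ℤ) - 1)
      · exact Or.inr c1
      · left
        by_cases c2 : t < n - 1
        · exact ⟨(t - 1).toNat, by omega, by omega⟩
        by_cases c3 : t < 2 * n - 2
        · exact ⟨(2 * n - 3 - t).toNat, by omega, by omega⟩
        by_cases c4 : t < 3 * n - 3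
        · exact ⟨(t - 2 * n + 1).toNat, by omega, by omega⟩
        · exact ⟨(4 * n - 5 - t).toNat, by omega, by omega⟩
  · rintro ⟨r, hr⟩ α β hα hanti hpos hSC
    have hsum : α 0 + α 1 = 4 * ((n - 1 : ℕ) : ℤ) := by
      have := add_eq_of_SC_two_eq_Icc (by omega) hSC
      omega
    have hd : α 0 = α 1 + 2 * (((α 0 - α 1) / 2).toNat : ℤ) := by
      by_cases hpar : (α 0 - α 1) % 2 = 0 <;> omega
    obtain ⟨q, hodd, hq⟩ := exists_odd_mul_of_Icc_eq_translates (N := n - 1) (by omega)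
      (by omega) hd (signedValues (n - 2) β)
      ((card_signedValues_le _ _).trans (by omega)) (by
        ext t
        have ht : t ∈ SC 2 (n - 2) α β ↔ t ∈ Set.Icc (1 : ℤ) (4 * (n : ℤ) - 5) := by rw [hSC]
        rw [mem_SC_two_iff_signedValues, Set.mem_Icc] at ht
        rw [Finset.mem_Icc, Finset.mem_insert,
          show t = 2 * ((n - 1 : ℕ) : ℤ) ↔ 2 * t = α 0 + α 1 by omega, ht]
        omega)
    have hq1 : q = 1 := by
      have hdvd : q ∣ 2 ^ r := ⟨_, by rw [← hr, mul_comm]; exact hq⟩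
      exact Nat.Coprime.eq_one_of_dvd (Nat.Coprime.pow_right r hodd.coprime_two_right) hdvd
    rw [hq1, mul_one] at hq
    have ha : α 0 = 3 * (n : ℤ) - 3 := by omega
    have hb : α 1 = (n : ℤ) - 1 := by omega
    refine ⟨ha, hb, fun j hj => ?_⟩
    have hle : ∀ j < n - 2, β j ≤ ((n - 2 : ℕ) : ℤ) := by
      intro i hi
      have hmem : α 1 - β i ∈ SC 2 (n - 2) α β := by
        rw [mem_SC_two]
        exact Or.inl ⟨i, hi, by simp⟩
      rw [hSC, Set.mem_Icc] at hmem
      omega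
    have := eq_of_strictAnti_of_mem_Icc hanti hpos hle j hj
    omega
end

section
/- Let n ≥ 2 and let λ ∈ ℚⁿ satisfy: all entries of λ lie in ℤ or all lie in ½ + ℤ, λ₁ ≥ λ₂, and λ₃ ≥ λ₄ ≥ … ≥ λ_n ≥ 0. Put (α₁, α₂, β₁, …, β_{n−2}) = λ + (n−½, n−³⁄₂, …, ½) and S = {α_i ± β_j : i ∈ {1,2}, 1 ≤ j ≤ n−2} ∪ {(α_i + α_j)/2 : 1 ≤ i ≤ j ≤ 2 and (α_i + α_j)/2 ∈ ℤ}. Then S = {1, 2, …, 4n−5} if and only if there exist integers p ≥ 1 and q ≥ 0 with n − 1 = p(2q+1) such that λ = (n−³⁄₂+p, n−½−p, 2pq+½, …, 2pq+½ (2p times), 2p(q−1)+½, …, 2p(q−1)+½ (2p times), …, 2p+½, …, 2p+½ (2p times), ½, …, ½ (p−1 times)). (This classifies the irreducible equivariant Ulrich bundles on the odd orthogonal Grassmannian of planes OGr(2, 2n+1).) -/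
/-- The entry number `i` (0-based) of `λ + ρ_B` for `SO(2n+1)`, where
`ρ_B = (n - 1/2, n - 3/2, …, 1/2)`. -/
def muB (n : ℕ) (lam : ℕ → ℚ) (i : ℕ) : ℚ :=
  lam i + (n : ℚ) - 1 / 2 - i

/-- The set `S` of integers of the form `αᵢ ± βⱼ` (`i ∈ {1,2}`, `1 ≤ j ≤ n-2`)
or `(αᵢ + αⱼ)/2 ∈ ℤ` (`1 ≤ i ≤ j ≤ 2`), where
`(α₁, α₂, β₁, …, β_{n-2}) = λ + ρ_B`.  In 0-based terms the α's are entries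
`0, 1` and the β's are entries `2, …, n-1` of `λ + ρ_B`. -/
def SOgr2 (n : ℕ) (lam : ℕ → ℚ) : Set ℤ :=
  {t | (∃ i < 2, ∃ j, 2 ≤ j ∧ j < n ∧
          ((t : ℚ) = muB n lam i + muB n lam j ∨
           (t : ℚ) = muB n lam i - muB n lam j)) ∨
       (∃ i j, i ≤ j ∧ j < 2 ∧ 2 * (t : ℚ) = muB n lam i + muB n lam j)}

/-- A decomposition of `[-M, M] \ {0}` as a direct sum `{-d, d} ⊕ B` with `B` symmetric and
containing `0` forces `M = 4dq + 2d - 1`, and determines `B`. -/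
theorem symmetric_tiling (B : ℤ → Prop) (d M : ℤ) (hd : 0 < d) (hM : 0 ≤ M)
    (heven : ∀ y, B y → B (-y)) (hzero : B 0)
    (hcover : ∀ x, -M ≤ x → x ≤ M → x ≠ 0 → B (x - d) ∨ B (x + d))
    (hbound : ∀ x, B (x - d) ∨ B (x + d) → -M ≤ x ∧ x ≤ M ∧ x ≠ 0)
    (hdisj : ∀ x, B (x - d) → ¬ B (x + d)) :
    ∃ q : ℕ, M = 4 * d * q + 2 * d - 1 ∧
      ∀ y, 0 < y → (B y ↔ y ≤ d - 1 ∨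
        ∃ k : ℤ, 1 ≤ k ∧ k ≤ q ∧ 4 * (d * k) - d ≤ y ∧ y ≤ 4 * (d * k) + d - 1) := by
  have ones (T : ℤ) (hgap : ∀ y, T - d + 1 ≤ y → y ≤ T + d → ¬ B y) (hT : T ≤ M) (y : ℤ)
      (h1 : T - 3 * d + 1 ≤ y) (h2 : y ≤ T - d) (h3 : y ≠ -d) (h4 : -M ≤ y + d) : B y := by
    rcases hcover (y + d) h4 (by omega) (by omega) with h | h
    · simpa using h
    · exact absurd h (hgap _ (by omega) (by omega))
  have gaps : ∀ j : ℕ, 4 * (d * j) ≤ M →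
      ∀ y, M - 4 * (d * j) - d + 1 ≤ y → y ≤ M - 4 * (d * j) + d → ¬ B y := by
    intro j
    induction j with
    | zero =>
      intro _ y h1 h2 hy
      have := hbound (y + d) (Or.inl (by simpa using hy))
      push_cast at h1
      omega
    | succ j ih =>
      intro hj y h1 h2 hy
      have e : d * ((j + 1 : ℕ) : ℤ) = d * j + d := by push_cast; ring
      rw [e] at hj h1 h2
      have hpos : 0 ≤ d * (j : ℤ) := by positivity
      have := ones _ (ih (by omega)) (by omega) (y + 2 * d) (by omega) (by omega) (by omega)
        (by omega)
      refine hdisj (y + d) (by simpa using hy) ?_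
      convert this using 1
      ring
  obtain ⟨q, hq⟩ : ∃ q : ℕ, (q : ℤ) = M / (4 * d) :=
    ⟨(M / (4 * d)).toNat, Int.toNat_of_nonneg (by positivity)⟩
  obtain ⟨r, hr⟩ : ∃ r, r = M % (4 * d) := ⟨_, rfl⟩
  have hr0 : 0 ≤ r := hr ▸ Int.emod_nonneg _ (by omega)
  have hr1 : r < 4 * d := hr ▸ Int.emod_lt_of_pos _ (by omega)
  have hMr : M = 4 * (d * q) + r := by
    rw [hq, hr, ← mul_assoc]; exact (Int.mul_ediv_add_emod M (4 * d)).symm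
  have hq0 : 0 ≤ d * (q : ℤ) := by positivity
  have hgap := gaps q (by omega)
  have hone := ones _ hgap (by omega)
  have hr2 : r < 2 * d := by
    by_contra! h
    have hBd := hone d (by omega) (by omega) (by omega) (by omega)
    exact (hbound 0 (Or.inr (by simpa using hBd))).2.2 rfl
  have hr3 : d ≤ r := by
    by_contra! h
    exact hgap 0 (by omega) (by omega) hzero
  have hr4 : r = 2 * d - 1 := by
    by_contra! h
    have := heven _ (hone (r - 3 * d + 1) (by omega) (by omega) (by omega) (by omega))
    exact hgap _ (by omega) (by omega) this
  refine ⟨q, by rw [hMr, hr4]; ring, fun y hy => ⟨fun hB => ?_, ?_⟩⟩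
  · by_contra! hcon
    obtain ⟨h1, h2⟩ := hcon
    have hyM := hbound (y + d) (Or.inl (by simpa using hB))
    obtain ⟨k, hk⟩ : ∃ k, k = (y + d) / (4 * d) := ⟨_, rfl⟩
    obtain ⟨s, hs⟩ : ∃ s, s = (y + d) % (4 * d) := ⟨_, rfl⟩
    have hs0 : 0 ≤ s := hs ▸ Int.emod_nonneg _ (by omega)
    have hs1 : s < 4 * d := hs ▸ Int.emod_lt_of_pos _ (by omega)
    have hys : y + d = 4 * (d * k) + s := by
      rw [hk, hs, ← mul_assoc]; exact (Int.mul_ediv_add_emod _ (4 * d)).symm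
    have hk0 : 0 ≤ k := hk ▸ Int.ediv_nonneg (by omega) (by omega)
    have hkq : k ≤ q := by
      by_contra! h
      have : d * ((q : ℤ) + 1) ≤ d * k := mul_le_mul_of_nonneg_left (by omega) hd.le
      rw [mul_add] at this
      omega
    have hs2 : 2 * d ≤ s := by
      rcases hk0.eq_or_lt with h | h
      · rw [← h] at hys
        simp at hys
        omega
      · have := h2 k (by omega) hkq (by omega)
        omega
    obtain ⟨j, hj⟩ := Int.eq_ofNat_of_zero_le (sub_nonneg.2 hkq)
    have e : d * (j : ℤ) = d * q - d * k := by rw [← mul_sub, hj]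
    have hdk : 0 ≤ d * k := by positivity
    have := gaps j (by omega) y (by omega) (by omega)
    exact this hB
  · rintro (h | ⟨k, hk1, hk2, h1, h2⟩)
    · exact hone y (by omega) (by omega) (by omega) (by omega)
    · obtain ⟨j, hj⟩ := Int.eq_ofNat_of_zero_le (sub_nonneg.2 hk2)
      have e : d * (j : ℤ) = d * q - d * k := by rw [← mul_sub, hj]
      have hdk : 0 ≤ d * k := by positivity
      have hdj : 0 ≤ d * (j : ℤ) := by positivity
      exact ones _ (gaps j (by omega)) (by omega) y (by omega) (by omega) (by omega) (by omega)

/-- The symmetric set of the preceding decomposition indeed yields `[-M, M]`. -/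
theorem tiling_covers (B : ℤ → Prop) (d : ℤ) (q : ℕ) (hd : 0 < d)
    (heven : ∀ y, B y → B (-y)) (hzero : B 0)
    (hB : ∀ y, 0 < y → (B y ↔ y ≤ d - 1 ∨
        ∃ k : ℤ, 1 ≤ k ∧ k ≤ q ∧ 4 * (d * k) - d ≤ y ∧ y ≤ 4 * (d * k) + d - 1)) (x : ℤ) :
    (x = 0 ∨ B (x - d) ∨ B (x + d)) ↔
      -(4 * d * q + 2 * d - 1) ≤ x ∧ x ≤ 4 * d * q + 2 * d - 1 := by
  have hq0 : 0 ≤ d * (q : ℤ) := by positivity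
  rw [mul_assoc]
  have hBle (y : ℤ) (hy : B y) : y ≤ 4 * (d * q) + d - 1 := by
    rcases le_or_gt y 0 with h | h
    · omega
    · rcases (hB y h).1 hy with h1 | ⟨k, -, hk2, -, h2⟩
      · omega
      · have := mul_le_mul_of_nonneg_left hk2 hd.le
        omega
  have cover (x : ℤ) (hx0 : 0 < x) (hx : x ≤ 4 * (d * q) + 2 * d - 1) :
      B (x - d) ∨ B (x + d) := by
    have hsmall (y : ℤ) (h1 : -d < y) (h2 : y < d) : B y := by
      rcases lt_trichotomy y 0 with h | h | h
      · have := heven (-y) ((hB (-y) (by omega)).2 (Or.inl (by omega)))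
        simpa using this
      · rwa [h]
      · exact (hB y h).2 (Or.inl (by omega))
    obtain ⟨k, hk⟩ : ∃ k, k = (x + 2 * d) / (4 * d) := ⟨_, rfl⟩
    obtain ⟨s, hs⟩ : ∃ s, s = (x + 2 * d) % (4 * d) := ⟨_, rfl⟩
    have hs0 : 0 ≤ s := hs ▸ Int.emod_nonneg _ (by omega)
    have hs1 : s < 4 * d := hs ▸ Int.emod_lt_of_pos _ (by omega)
    have hxs : x + 2 * d = 4 * (d * k) + s := by
      rw [hk, hs, ← mul_assoc]; exact (Int.mul_ediv_add_emod _ (4 * d)).symm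
    have hk0 : 0 ≤ k := hk ▸ Int.ediv_nonneg (by omega) (by omega)
    have hkq : k ≤ q := by
      by_contra! h
      have : d * ((q : ℤ) + 1) ≤ d * k := mul_le_mul_of_nonneg_left (by omega) hd.le
      rw [mul_add] at this
      omega
    rcases hk0.eq_or_lt with h | h
    · rw [← h] at hxs
      simp at hxs
      exact Or.inl (hsmall _ (by omega) (by omega))
    · have hdk : d * 1 ≤ d * k := mul_le_mul_of_nonneg_left (by omega) hd.le
      rcases lt_or_ge s (2 * d) with h' | h'
      · exact Or.inr ((hB _ (by omega)).2 (Or.inr ⟨k, by omega, hkq, by omega, by omega⟩))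
      · exact Or.inl ((hB _ (by omega)).2 (Or.inr ⟨k, by omega, hkq, by omega, by omega⟩))
  constructor
  · rintro (h | h | h)
    · omega
    · have := hBle _ h
      have := hBle _ (heven _ h)
      omega
    · have := hBle _ h
      have := hBle _ (heven _ h)
      omega
  · rintro ⟨h1, h2⟩
    rcases lt_trichotomy x 0 with h | h | h
    · rcases cover (-x) (by omega) (by omega) with h' | h'
      · have := heven _ h'
        refine Or.inr (Or.inr ?_)
        convert this using 1
        ring
      · have := heven _ h'
        refine Or.inr (Or.inl ?_)
        convert this using 1
        ring
    · exact Or.inl h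
    · exact Or.inr (cover x h h2)

/-- Decreasing enumeration of the positive part of the set `B` in `symmetric_tiling`. -/
def blockSeq (p q i : ℕ) : ℤ :=
  p * (4 * q + 1) - 1 - i - 2 * p * (i / (2 * p) : ℕ)

theorem blockSeq_strictAnti (p q : ℕ) : StrictAnti (blockSeq p q) := by
  intro i j hij
  have h : i / (2 * p) ≤ j / (2 * p) := Nat.div_le_div_right hij.le
  have h' : (2 * p * (i / (2 * p) : ℕ) : ℤ) ≤ 2 * p * (j / (2 * p) : ℕ) := by
    exact_mod_cast Nat.mul_le_mul_left _ h
  unfold blockSeq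
  omega

theorem blockSeq_eq (p q m r : ℕ) (hr : r < 2 * p) :
    blockSeq p q (2 * p * m + r) = 4 * (p * ((q : ℤ) - m)) + p - 1 - r := by
  have h : (2 * p * m + r) / (2 * p) = m := by
    rw [Nat.mul_add_div (by omega), Nat.div_eq_of_lt hr, add_zero]
  unfold blockSeq
  rw [h]
  push_cast
  ring

theorem exists_blockSeq_eq_iff (p q : ℕ) (hp : 1 ≤ p) (y : ℤ) :
    (∃ i < 2 * p * q + p - 1, blockSeq p q i = y) ↔
      0 < y ∧ (y ≤ p - 1 ∨ ∃ k : ℤ, 1 ≤ k ∧ k ≤ q ∧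
        4 * ((p : ℤ) * k) - p ≤ y ∧ y ≤ 4 * ((p : ℤ) * k) + p - 1) := by
  constructor
  · rintro ⟨i, hi, rfl⟩
    have hir := Nat.div_add_mod i (2 * p)
    have hr : i % (2 * p) < 2 * p := Nat.mod_lt _ (by omega)
    generalize i / (2 * p) = m at hir
    generalize i % (2 * p) = r at hir hr
    subst hir
    rw [blockSeq_eq p q m r hr]
    have hmq : m ≤ q := by
      by_contra! h
      have := Nat.mul_le_mul_left (2 * p) (Nat.succ_le_of_lt h)
      rw [Nat.mul_succ] at this
      omega
    rcases hmq.eq_or_lt with rfl | h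
    · simp
      omega
    · have : (p : ℤ) * 1 ≤ p * ((q : ℤ) - m) := mul_le_mul_of_nonneg_left (by omega) (by omega)
      refine ⟨by omega, Or.inr ⟨(q : ℤ) - m, by omega, by omega, by omega, by omega⟩⟩
  · rintro ⟨hy, h | ⟨k, hk1, hkq, h1, h2⟩⟩
    · obtain ⟨r, hr⟩ := Int.eq_ofNat_of_zero_le (sub_nonneg.2 h)
      refine ⟨2 * p * q + r, by omega, ?_⟩
      rw [blockSeq_eq p q q r (by omega)]
      simp
      omega
    · obtain ⟨r, hr⟩ := Int.eq_ofNat_of_zero_le (sub_nonneg.2 h2)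
      obtain ⟨m, hm⟩ := Int.eq_ofNat_of_zero_le (sub_nonneg.2 hkq)
      have hmq := Nat.mul_le_mul_left (2 * p) (show m + 1 ≤ q by omega)
      rw [mul_add] at hmq
      refine ⟨2 * p * m + r, by omega, ?_⟩
      rw [blockSeq_eq p q m r (by omega), ← hm, sub_sub_cancel]
      omega

/-- The symmetric set `{0} ∪ {±βⱼ}`. -/
def betaSet (n : ℕ) (lam : ℕ → ℚ) : Set ℚ :=
  {y | y = 0 ∨ ∃ j, 2 ≤ j ∧ j < n ∧ (y = muB n lam j ∨ y = -muB n lam j)}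

theorem neg_mem_betaSet {n : ℕ} {lam : ℕ → ℚ} {y : ℚ} (hy : y ∈ betaSet n lam) :
    -y ∈ betaSet n lam := by
  rcases hy with rfl | ⟨j, h1, h2, rfl | rfl⟩
  · exact Or.inl neg_zero
  · exact Or.inr ⟨j, h1, h2, Or.inr rfl⟩
  · exact Or.inr ⟨j, h1, h2, Or.inl (neg_neg _)⟩

theorem mem_SOgr2_iff (n : ℕ) (lam : ℕ → ℚ) (t : ℤ) :
    t ∈ SOgr2 n lam ↔ (t : ℚ) = (muB n lam 0 + muB n lam 1) / 2 ∨
      (t : ℚ) - muB n lam 0 ∈ betaSet n lam ∨ (t : ℚ) - muB n lam 1 ∈ betaSet n lam := by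
  constructor
  · rintro (⟨i, hi, j, h1, h2, h⟩ | ⟨i, j, hij, hj, h⟩)
    · have key : (t : ℚ) - muB n lam i ∈ betaSet n lam := by
        refine Or.inr ⟨j, h1, h2, h.imp (fun h => ?_) (fun h => ?_)⟩ <;> linarith
      interval_cases i
      · exact Or.inr (Or.inl key)
      · exact Or.inr (Or.inr key)
    · interval_cases j <;> interval_cases i
      · exact Or.inr (Or.inl (Or.inl (by linarith)))
      · exact Or.inl (by linarith)
      · exact Or.inr (Or.inr (Or.inl (by linarith)))
  · have key (i : ℕ) (hi : i < 2) (h : (t : ℚ) - muB n lam i ∈ betaSet n lam) :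
        t ∈ SOgr2 n lam := by
      rcases h with h | ⟨j, h1, h2, h⟩
      · exact Or.inr ⟨i, i, le_rfl, hi, by linarith⟩
      · refine Or.inl ⟨i, hi, j, h1, h2, h.imp (fun h => ?_) (fun h => ?_)⟩ <;> linarith
    rintro (h | h | h)
    · exact Or.inr ⟨0, 1, by omega, by omega, by linarith⟩
    · exact key 0 (by omega) h
    · exact key 1 (by omega) h

/-- The elements of `{0} ∪ {±βⱼ}`, listed with multiplicity. -/
def betaVal (n : ℕ) (lam : ℕ → ℚ) : Option (Fin (n - 2) × Bool) → ℚ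
  | none => 0
  | some (j, true) => muB n lam (j + 2)
  | some (j, false) => -muB n lam (j + 2)

theorem range_betaVal (n : ℕ) (lam : ℕ → ℚ) : Set.range (betaVal n lam) = betaSet n lam := by
  ext y
  constructor
  · rintro ⟨_ | ⟨j, _ | _⟩, rfl⟩
    · exact Or.inl rfl
    · exact Or.inr ⟨j + 2, by omega, by omega, Or.inr rfl⟩
    · exact Or.inr ⟨j + 2, by omega, by omega, Or.inl rfl⟩
  · rintro (rfl | ⟨j, h1, h2, h⟩)
    · exact ⟨none, rfl⟩
    · obtain ⟨i, rfl⟩ := Nat.exists_eq_add_of_le' h1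
      rcases h with rfl | rfl
      · exact ⟨some (⟨i, by omega⟩, true), rfl⟩
      · exact ⟨some (⟨i, by omega⟩, false), rfl⟩

/-- The rational numbers whose integral members form `S`, listed with multiplicity. -/
def candVal (n : ℕ) (lam : ℕ → ℚ) : Option (Fin 2 × Option (Fin (n - 2) × Bool)) → ℚ
  | none => (muB n lam 0 + muB n lam 1) / 2
  | some (i, o) => muB n lam i + betaVal n lam o

theorem mem_SOgr2_iff_mem_range (n : ℕ) (lam : ℕ → ℚ) (t : ℤ) :
    t ∈ SOgr2 n lam ↔ (t : ℚ) ∈ Set.range (candVal n lam) := by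
  rw [mem_SOgr2_iff, ← range_betaVal]
  constructor
  · rintro (h | ⟨o, h⟩ | ⟨o, h⟩)
    · exact ⟨none, h.symm⟩
    · exact ⟨some (0, o), by simp [candVal, h]⟩
    · exact ⟨some (1, o), by simp [candVal, h]⟩
  · rintro ⟨_ | ⟨i, o⟩, h⟩
    · exact Or.inl h.symm
    · refine Or.inr ?_
      fin_cases i
      · exact Or.inl ⟨o, by simp [candVal] at h; linarith⟩
      · exact Or.inr ⟨o, by simp [candVal] at h; linarith⟩

/-- Since `S` has at most `4n - 5` candidate elements, they must all be integral and distinct. -/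
theorem candVal_of_SOgr2_eq {n : ℕ} (hn : 2 ≤ n) {lam : ℕ → ℚ}
    (h : SOgr2 n lam = Set.Icc (1 : ℤ) (4 * (n : ℤ) - 5)) :
    Function.Injective (candVal n lam) ∧
      ∀ a, ∃ t : ℤ, candVal n lam a = t := by
  classical
  have hsub : (Finset.Icc (1 : ℤ) (4 * n - 5)).image (Int.cast : ℤ → ℚ) ⊆
      Finset.univ.image (candVal n lam) := by
    intro y hy
    obtain ⟨t, ht, rfl⟩ := Finset.mem_image.1 hy
    have : t ∈ SOgr2 n lam := by rw [h]; simpa using ht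
    obtain ⟨a, ha⟩ := (mem_SOgr2_iff_mem_range n lam t).1 this
    exact Finset.mem_image.2 ⟨a, Finset.mem_univ _, ha⟩
  have hcard1 : ((Finset.Icc (1 : ℤ) (4 * n - 5)).image (Int.cast : ℤ → ℚ)).card = 4 * n - 5 := by
    rw [Finset.card_image_of_injective _ Int.cast_injective, Int.card_Icc]
    omega
  have hcard2 : (Finset.univ : Finset (Option (Fin 2 × Option (Fin (n - 2) × Bool)))).card
      = 4 * n - 5 := by
    simp only [Finset.card_univ, Fintype.card_option, Fintype.card_prod, Fintype.card_fin,
      Fintype.card_bool]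
    omega
  have hle := Finset.card_image_le (s := Finset.univ) (f := candVal n lam)
  have heq := Finset.eq_of_subset_of_card_le hsub (by omega)
  constructor
  · rw [heq, ← hcard2, Finset.card_image_iff] at hcard1
    simpa using hcard1
  · intro a
    have ha : candVal n lam a ∈ Finset.univ.image (candVal n lam) :=
      Finset.mem_image_of_mem _ (Finset.mem_univ a)
    rw [← heq] at ha
    obtain ⟨t, -, ht⟩ := Finset.mem_image.1 ha
    exact ⟨t, ht.symm⟩

theorem muB_eq_blockSeq_iff {n p q : ℕ} {lam : ℕ → ℚ} (hp : 1 ≤ p)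
    (hn : n = 2 * p * q + p + 1) :
    (∀ i < n - 2, muB n lam (i + 2) = blockSeq p q i) ↔
      (∀ m s : ℕ, m < q → 1 ≤ s → s ≤ 2 * p →
        lam (2 * p * m + s + 1) = 2 * (p : ℚ) * ((q : ℚ) - m) + 1 / 2) ∧
      (∀ s : ℕ, 1 ≤ s → s ≤ p - 1 → lam (2 * p * q + s + 1) = 1 / 2) := by
  have key (m r : ℕ) (hr : r < 2 * p) :
      muB n lam (2 * p * m + r + 2) = blockSeq p q (2 * p * m + r) ↔
        lam (2 * p * m + (r + 1) + 1) = 2 * (p : ℚ) * ((q : ℚ) - m) + 1 / 2 := by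
    rw [blockSeq_eq p q m r hr, muB, hn]
    push_cast
    rw [show 2 * p * m + (r + 1) + 1 = 2 * p * m + r + 2 by ring]
    constructor <;> intro h <;> linear_combination h
  have lt_of_block (m r : ℕ) (hm : m < q) (hr : r < 2 * p) : 2 * p * m + r < n - 2 := by
    have := Nat.mul_le_mul_left (2 * p) (Nat.succ_le_of_lt hm)
    rw [Nat.mul_succ] at this
    omega
  constructor
  · intro h
    constructor
    · intro m s hm hs1 hs2
      obtain ⟨r, rfl⟩ := Nat.exists_eq_add_of_le' hs1
      exact (key m r (by omega)).1 (h _ (lt_of_block m r hm (by omega)))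
    · intro s hs1 hs2
      obtain ⟨r, rfl⟩ := Nat.exists_eq_add_of_le' hs1
      simpa using (key q r (by omega)).1 (h _ (by omega))
  · rintro ⟨h1, h2⟩ i hi
    have hir := Nat.div_add_mod i (2 * p)
    have hr : i % (2 * p) < 2 * p := Nat.mod_lt _ (by omega)
    generalize i / (2 * p) = m at hir
    generalize i % (2 * p) = r at hir hr
    subst hir
    rw [key m r hr]
    have hmq : m ≤ q := by
      by_contra! h
      have := Nat.mul_le_mul_left (2 * p) (Nat.succ_le_of_lt h)
      rw [Nat.mul_succ] at this
      omega
    rcases hmq.eq_or_lt with rfl | h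
    · simpa using h2 (r + 1) (by omega) (by omega)
    · exact h1 m (r + 1) h (by omega) (by omega)

theorem intCast_mem_betaSet_iff {n : ℕ} {lam : ℕ → ℚ} {β : ℕ → ℤ}
    (hβ : ∀ i < n - 2, muB n lam (i + 2) = β i) (hpos : ∀ i < n - 2, 0 < β i)
    {y : ℤ} (hy : 0 < y) : (y : ℚ) ∈ betaSet n lam ↔ ∃ i < n - 2, β i = y := by
  constructor
  · rintro (h | ⟨j, h1, h2, h⟩)
    · exact absurd (Int.cast_eq_zero.1 h) hy.ne'
    · obtain ⟨i, rfl⟩ := Nat.exists_eq_add_of_le' h1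
      have hi : i < n - 2 := by omega
      rw [hβ i hi] at h
      norm_cast at h
      have := hpos i hi
      exact ⟨i, hi, by omega⟩
  · rintro ⟨i, hi, rfl⟩
    exact Or.inr ⟨i + 2, by omega, by omega, Or.inl (hβ i hi).symm⟩

theorem SOgr2_eq_of_blockSeq {n p q : ℕ} {lam : ℕ → ℚ} (hp : 1 ≤ p)
    (hn : n = 2 * p * q + p + 1) (h0 : lam 0 = (n : ℚ) - 3 / 2 + p)
    (h1 : lam 1 = (n : ℚ) - 1 / 2 - p)
    (hβ : ∀ i < n - 2, muB n lam (i + 2) = blockSeq p q i) :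
    SOgr2 n lam = Set.Icc (1 : ℤ) (4 * (n : ℤ) - 5) := by
  have hN : n - 2 = 2 * p * q + p - 1 := by omega
  have hpos (i : ℕ) (hi : i < n - 2) : 0 < blockSeq p q i :=
    ((exists_blockSeq_eq_iff p q hp _).1 ⟨i, hN ▸ hi, rfl⟩).1
  have hcov := tiling_covers (fun y => (y : ℚ) ∈ betaSet n lam) p q (by omega)
    (fun y hy => by push_cast; exact neg_mem_betaSet hy) (Or.inl (by simp))
    (fun y hy => by
      rw [intCast_mem_betaSet_iff hβ hpos hy, hN, exists_blockSeq_eq_iff p q hp]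
      simp [hy])
  ext t
  have e0 : muB n lam 0 = ((2 * n - 2 + p : ℤ) : ℚ) := by
    rw [muB, h0]; push_cast; ring
  have e1 : muB n lam 1 = ((2 * n - 2 - p : ℤ) : ℚ) := by
    rw [muB, h1]; push_cast; ring
  have ec : (muB n lam 0 + muB n lam 1) / 2 = ((2 * n - 2 : ℤ) : ℚ) := by
    rw [e0, e1]; push_cast; ring
  rw [mem_SOgr2_iff, ec, e0, e1, ← Int.cast_sub, ← Int.cast_sub, Set.mem_Icc]
  rw [Int.cast_inj, ← sub_eq_zero, ← sub_sub t (2 * n - 2) p,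
    ← sub_add t (2 * n - 2) p]
  have hM : (4 * p * q + 2 * p - 1 : ℤ) = 2 * n - 3 := by
    rw [hn]; push_cast; ring
  refine (hcov (t - (2 * n - 2))).trans ?_
  rw [hM]
  omega

theorem blockSeq_of_SOgr2_eq {n : ℕ} (hn : 2 ≤ n) {lam : ℕ → ℚ}
    (h12 : lam 1 ≤ lam 0)
    (hdec : ∀ i, 2 ≤ i → i + 1 < n → lam (i + 1) ≤ lam i)
    (hpos : ∀ i, 2 ≤ i → i < n → 0 ≤ lam i)
    (hS : SOgr2 n lam = Set.Icc (1 : ℤ) (4 * (n : ℤ) - 5)) :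
    ∃ p q : ℕ, 1 ≤ p ∧ n = 2 * p * q + p + 1 ∧ lam 0 = (n : ℚ) - 3 / 2 + p ∧
      lam 1 = (n : ℚ) - 1 / 2 - p ∧ ∀ i < n - 2, muB n lam (i + 2) = blockSeq p q i := by
  obtain ⟨hinj, hcand⟩ := candVal_of_SOgr2_eq hn hS
  obtain ⟨a₀, ha₀⟩ := hcand (some (0, none))
  obtain ⟨a₁, ha₁⟩ := hcand (some (1, none))
  obtain ⟨c, hc⟩ := hcand none
  simp only [candVal, betaVal, add_zero, Fin.val_zero, Fin.val_one] at ha₀ ha₁ hc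
  have hac : a₀ + a₁ = 2 * c := by
    rw [ha₀, ha₁, div_eq_iff two_ne_zero] at hc
    norm_cast at hc
    omega
  have hlt : a₁ < a₀ := by
    have : (a₁ : ℚ) < a₀ := by
      rw [← ha₀, ← ha₁, muB, muB]
      push_cast
      linarith
    exact_mod_cast this
  obtain ⟨p, hp⟩ := Int.eq_ofNat_of_zero_le (show 0 ≤ c - a₁ by omega)
  obtain rfl : a₀ = c + p := by omega
  obtain rfl : a₁ = c - p := by omega
  have hp1 : 1 ≤ p := by omega
  have hmem (t : ℤ) : (1 ≤ t ∧ t ≤ 4 * (n : ℤ) - 5) ↔ t = c ∨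
      ((t - c - p : ℤ) : ℚ) ∈ betaSet n lam ∨ ((t - c + p : ℤ) : ℚ) ∈ betaSet n lam := by
    rw [← Set.mem_Icc, ← hS, mem_SOgr2_iff, hc, ha₀, ha₁, ← Int.cast_sub, ← Int.cast_sub,
      Int.cast_inj, sub_sub, sub_sub_eq_add_sub, sub_add_eq_add_sub]
  have hsymm (t : ℤ) (ht : 1 ≤ t ∧ t ≤ 4 * (n : ℤ) - 5) :
      1 ≤ 2 * c - t ∧ 2 * c - t ≤ 4 * (n : ℤ) - 5 := by
    rw [hmem] at ht ⊢
    rcases ht with h | h | h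
    · exact Or.inl (by omega)
    · refine Or.inr (Or.inr ?_)
      convert neg_mem_betaSet h using 1
      push_cast
      ring
    · refine Or.inr (Or.inl ?_)
      convert neg_mem_betaSet h using 1
      push_cast
      ring
  obtain rfl : c = 2 * n - 2 := by
    have := hsymm 1 (by omega)
    have := hsymm (4 * n - 5) (by omega)
    omega
  have hdisj (x : ℤ) (h₀ : ((x - p : ℤ) : ℚ) ∈ betaSet n lam)
      (h₁ : ((x + p : ℤ) : ℚ) ∈ betaSet n lam) : False := by
    rw [← range_betaVal] at h₀ h₁
    obtain ⟨o, ho⟩ := h₀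
    obtain ⟨o', ho'⟩ := h₁
    have : candVal n lam (some (0, o)) = candVal n lam (some (1, o')) := by
      simp only [candVal, ho, ho', Fin.val_zero, Fin.val_one, ha₀, ha₁]
      push_cast
      ring
    simpa using hinj this
  have hne (h : ((p : ℤ) : ℚ) ∈ betaSet n lam) : False := by
    rw [← range_betaVal] at h
    obtain ⟨o, ho⟩ := h
    have : candVal n lam (some (1, o)) = candVal n lam none := by
      rw [show candVal n lam none = _ from hc]
      simp only [candVal, ho, Fin.val_one, ha₁]
      push_cast
      ring
    simpa using hinj this
  obtain ⟨q, hq, hB⟩ := symmetric_tiling (fun y => (y : ℚ) ∈ betaSet n lam) p (2 * n - 3)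
    (by omega) (by omega) (fun y hy => by push_cast; exact neg_mem_betaSet hy)
    (Or.inl (by simp))
    (fun x h1 h2 h3 => by
      have := (hmem (x + (2 * n - 2))).1 (by omega)
      rw [add_sub_cancel_right] at this
      exact this.resolve_left (by omega))
    (fun x hx => by
      have := (hmem (x + (2 * n - 2))).2 (Or.inr (by rwa [add_sub_cancel_right]))
      refine ⟨by omega, by omega, ?_⟩
      rintro rfl
      rcases hx with hx | hx
      · refine hne ?_
        convert neg_mem_betaSet hx using 1
        push_cast
        ring
      · exact hne (by simpa using hx))
    (fun x h₀ h₁ => hdisj x h₀ h₁)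
  have hnpq : n = 2 * p * q + p + 1 := by
    have : (4 * p * q : ℤ) = 2 * (2 * p * q : ℕ) := by push_cast; ring
    omega
  refine ⟨p, q, hp1, hnpq, ?_, ?_, ?_⟩
  · rw [muB] at ha₀
    push_cast at ha₀
    linarith
  · rw [muB] at ha₁
    push_cast at ha₁
    linarith
  · have hint (i : ℕ) : ∃ b : ℤ, i < n - 2 → muB n lam (i + 2) = b := by
      by_cases hi : i < n - 2
      · obtain ⟨t, ht⟩ := hcand (some (0, some (⟨i, hi⟩, true)))
        simp only [candVal, betaVal, Fin.val_zero, ha₀] at ht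
        refine ⟨t - (2 * n - 2 + p), fun _ => ?_⟩
        rw [Int.cast_sub]
        linarith
      · exact ⟨0, fun h => absurd h hi⟩
    choose β hβ using hint
    have hβpos (i : ℕ) (hi : i < n - 2) : 0 < β i := by
      have h1 := hpos (i + 2) (by omega) (by omega)
      have h2 := hβ i hi
      have h3 : ((i + 3 : ℕ) : ℚ) ≤ n := by exact_mod_cast (by omega : i + 3 ≤ n)
      rw [muB] at h2
      push_cast at h2 h3
      have : (0 : ℚ) < β i := by linarith
      exact_mod_cast this
    have hN : n - 2 = 2 * p * q + p - 1 := by omega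
    have hanti : StrictAnti (fun i : Fin (n - 2) => β i) := by
      have hlam : AntitoneOn lam (Set.Ico 2 n) := by
        refine antitoneOn_of_succ_le Set.ordConnected_Ico fun i _ hi hi' => ?_
        exact hdec i hi.1 hi'.2
      intro i j hij
      have h1 := hlam (a := i + 2) (b := j + 2) ⟨by omega, by omega⟩ ⟨by omega, by omega⟩
        (by have := Fin.lt_def.1 hij; omega)
      have h2 : ((i : ℕ) : ℚ) < (j : ℕ) := by exact_mod_cast hij
      have h3 := hβ i i.2
      have h4 := hβ j j.2
      rw [muB] at h3 h4
      push_cast at h3 h4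
      have : (β j : ℚ) < β i := by linarith
      exact_mod_cast this
    have hrange : Set.range (fun i : Fin (n - 2) => β i) =
        Set.range (fun i : Fin (n - 2) => blockSeq p q i) := by
      ext y
      have e1 := exists_blockSeq_eq_iff p q hp1 y
      have e2 : (∃ i < n - 2, β i = y) ↔ 0 < y ∧ (y : ℚ) ∈ betaSet n lam := by
        constructor
        · rintro ⟨i, hi, rfl⟩
          exact ⟨hβpos i hi, (intCast_mem_betaSet_iff hβ hβpos (hβpos i hi)).2 ⟨i, hi, rfl⟩⟩
        · rintro ⟨hy, h⟩
          exact (intCast_mem_betaSet_iff hβ hβpos hy).1 h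
      rw [← hN] at e1
      have e3 := e2.trans ((and_congr_right (hB y)).trans e1.symm)
      simpa [Fin.exists_iff] using e3
    have hfun := (StrictAnti.range_inj hanti
      (fun i j hij => blockSeq_strictAnti p q (Fin.lt_def.1 hij))).1 hrange
    intro i hi
    rw [hβ i hi]
    exact_mod_cast congrFun hfun ⟨i, hi⟩

/-- Classification of irreducible equivariant Ulrich bundles on `OGr(2, 2n+1)`:
for a weight `λ` (entries all integers or all half-odd-integers, with
`λ₁ ≥ λ₂` and `λ₃ ≥ … ≥ λ_n ≥ 0`), `S = {1, …, 4n-5}` iff there are integers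
`p ≥ 1`, `q ≥ 0` with `n - 1 = p(2q+1)` and
`λ = (n - 3/2 + p, n - 1/2 - p, 2pq + 1/2 (2p times), …, 2p + 1/2 (2p times),
1/2 (p-1 times))`. -/
theorem stmt7 (n : ℕ) (hn : 2 ≤ n) (lam : ℕ → ℚ)
    (hint : (∀ i < n, ∃ m : ℤ, lam i = m) ∨ (∀ i < n, ∃ m : ℤ, lam i = m + 1 / 2))
    (h12 : lam 1 ≤ lam 0)
    (hdec : ∀ i, 2 ≤ i → i + 1 < n → lam (i + 1) ≤ lam i)
    (hpos : ∀ i, 2 ≤ i → i < n → 0 ≤ lam i) :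
    SOgr2 n lam = Set.Icc (1 : ℤ) (4 * (n : ℤ) - 5) ↔
    ∃ p q : ℕ, 1 ≤ p ∧ n - 1 = p * (2 * q + 1) ∧
      lam 0 = (n : ℚ) - 3 / 2 + p ∧ lam 1 = (n : ℚ) - 1 / 2 - p ∧
      (∀ m s : ℕ, m < q → 1 ≤ s → s ≤ 2 * p →
        lam (2 * p * m + s + 1) = 2 * (p : ℚ) * ((q : ℚ) - m) + 1 / 2) ∧
      (∀ s : ℕ, 1 ≤ s → s ≤ p - 1 → lam (2 * p * q + s + 1) = 1 / 2) := by
  have hnp (p q : ℕ) : n - 1 = p * (2 * q + 1) ↔ n = 2 * p * q + p + 1 := by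
    rw [show p * (2 * q + 1) = 2 * p * q + p by ring]
    omega
  constructor
  · intro hS
    obtain ⟨p, q, hp, hpq, h0, h1, hβ⟩ := blockSeq_of_SOgr2_eq hn h12 hdec hpos hS
    exact ⟨p, q, hp, (hnp p q).2 hpq, h0, h1, (muB_eq_blockSeq_iff hp hpq).1 hβ⟩
  · rintro ⟨p, q, hp, hpq, h0, h1, h⟩
    rw [hnp] at hpq
    exact SOgr2_eq_of_blockSeq hp hpq h0 h1 ((muB_eq_blockSeq_iff hp hpq).2 h)
end
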